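/- arXiv:math/0512477 — 7 statements merged into one kernel-verified Lean document; each statement's English description precedes it below -/
import Mathlib

section
/- Let F be a field of characteristic zero and let L be a semisimple Lie algebra over F of dimension 3. Then L is isomorphic (as a Lie algebra over F) to sl₂(F) if and only if the Killing form of L is isotropic, i.e. there exists a nonzero element a ∈ L with κ(a,a) = 0. -/
open Module LieAlgebra LinearMap in
/-- In a Lie algebra with nondegenerate Killing form, adjoint endomorphisms have trace zero. -/
lemma LieAlgebra.IsKilling.trace_ad_eq_zero {F L : Type*} [Field F] [LieRing L] [LieAlgebra F L]
    [Module.Finite F L] [IsKilling F L] (x : L) : trace F L (ad F L x) = 0 := by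
  let T : Dual F L := trace F L ∘ₗ (ad F L : L →ₗ[F] End F L)
  obtain ⟨z, hz⟩ : ∃ z, killingForm F L z = T :=
    (injective_iff_surjective_of_finrank_eq_finrank Subspace.dual_finrank_eq.symm).mp
      (ker_eq_bot.mp (IsKilling.ker_killingForm_eq_bot F L)) T
  have hT (u v : L) : T ⁅u, v⁆ = 0 := by
    simp [T, LieRing.of_associative_ring_bracket, trace_mul_comm F (ad F L u)]
  have hz_zero (u : L) : ⁅z, u⁆ = 0 := by
    refine ker_eq_bot'.mp (IsKilling.ker_killingForm_eq_bot F L) _ ?_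
    ext v
    rw [LieModule.traceForm_apply_lie_apply, hz, hT, LinearMap.zero_apply]
  have had : ad F L z = 0 := by ext u; simpa using hz_zero u
  have := congr($hz x)
  rw [killingForm_apply_apply, had, zero_comp, map_zero] at this
  exact this.symm

/-- A `3 × 3` matrix `M` with `det M = tr M = tr (M²) = 0` satisfies `M³ = 0`. -/
lemma Matrix.pow_three_eq_zero_of_trace_eq_zero {F : Type*} [Field F] [CharZero F]
    {M : Matrix (Fin 3) (Fin 3) F} (hdet : M.det = 0) (htr : M.trace = 0)
    (htr₂ : (M * M).trace = 0) : M * M * M = 0 := by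
  rw [Matrix.det_fin_three] at hdet
  simp only [Matrix.trace_fin_three, Matrix.mul_apply, Fin.sum_univ_three] at htr htr₂
  have hc : M 0 0 * M 1 1 - M 0 1 * M 1 0 + (M 0 0 * M 2 2 - M 0 2 * M 2 0) +
      (M 1 1 * M 2 2 - M 1 2 * M 2 1) = 0 := by
    linear_combination (M 0 0 + M 1 1 + M 2 2) / 2 * htr - htr₂ / 2
  ext i j
  have key : (M * M * M) i j = (M 0 0 + M 1 1 + M 2 2) * (M * M) i j -
      (M 0 0 * M 1 1 - M 0 1 * M 1 0 + (M 0 0 * M 2 2 - M 0 2 * M 2 0) +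
        (M 1 1 * M 2 2 - M 1 2 * M 2 1)) * M i j +
      (M 0 0 * M 1 1 * M 2 2 - M 0 0 * M 1 2 * M 2 1 - M 0 1 * M 1 0 * M 2 2 +
        M 0 1 * M 1 2 * M 2 0 + M 0 2 * M 1 0 * M 2 1 - M 0 2 * M 1 1 * M 2 0) *
        (1 : Matrix (Fin 3) (Fin 3) F) i j := by
    fin_cases i <;> fin_cases j <;>
      simp [Matrix.mul_apply, Fin.sum_univ_three] <;> ring
  rw [key, htr, hc, hdet]
  simp

open LinearMap in
/-- A singular endomorphism `D` of a three-dimensional space with `tr D = tr (D²) = 0` satisfies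
`D³ = 0`. -/
lemma LinearMap.pow_three_eq_zero_of_trace_eq_zero {F V : Type*} [Field F] [CharZero F]
    [AddCommGroup V] [Module F V] [Module.Finite F V] (hdim : Module.finrank F V = 3)
    {D : V →ₗ[F] V} {a : V} (ha : a ≠ 0) (hDa : D a = 0)
    (htr : trace F V D = 0) (htr₂ : trace F V (D ∘ₗ D) = 0) (x : V) : D (D (D x)) = 0 := by
  let b := Module.finBasisOfFinrankEq F V hdim
  have hdet : (toMatrix b b D).det = 0 := by
    rw [LinearMap.det_toMatrix]
    by_contra h
    exact ha ((LinearMap.equivOfDetNeZero D h).map_eq_zero_iff.mp hDa)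
  rw [trace_eq_matrix_trace F b] at htr htr₂
  rw [toMatrix_comp b b b] at htr₂
  have h := Matrix.pow_three_eq_zero_of_trace_eq_zero hdet htr htr₂
  rw [← toMatrix_comp b b b, ← toMatrix_comp b b b, LinearEquiv.map_eq_zero_iff] at h
  exact congr($h x)

/-- A Jordan chain `f ↦ h ↦ c • e ↦ 0` with `c ≠ 0` and `e ≠ 0` is linearly independent. -/
lemma LinearMap.linearIndependent_of_chain {F V : Type*} [Field F] [AddCommGroup V] [Module F V]
    {D : V →ₗ[F] V} {e h f : V} {c : F} (hc : c ≠ 0) (he : e ≠ 0)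
    (hDf : D f = h) (hDh : D h = c • e) (hDe : D e = 0) : LinearIndependent F ![e, h, f] := by
  refine Fintype.linearIndependent_iff.mpr fun g hg ↦ ?_
  replace hg : g 0 • e + g 1 • h + g 2 • f = 0 := by simpa [Fin.sum_univ_three] using hg
  have hg₁ : (g 1 * c) • e + g 2 • h = 0 := by
    simpa [hDf, hDh, hDe, smul_smul] using congr(D $hg)
  have h₂ : g 2 = 0 := by simpa [hDf, hDh, hDe, hc, he] using congr(D $hg₁)
  have h₁ : g 1 = 0 := by simpa [h₂, hc, he] using hg₁
  have h₀ : g 0 = 0 := by simpa [h₁, h₂, he] using hg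
  intro i
  fin_cases i <;> assumption

/-- Three linearly independent vectors span a three-dimensional space. -/
lemma LinearIndependent.exists_eq_smul_add_smul_add_smul {F V : Type*} [Field F] [AddCommGroup V]
    [Module F V] (hdim : Module.finrank F V = 3) {u v w : V}
    (hli : LinearIndependent F ![u, v, w]) (x : V) :
    ∃ α β γ : F, x = α • u + β • v + γ • w := by
  let b := basisOfLinearIndependentOfCardEqFinrank hli (by simp [hdim])
  refine ⟨b.repr x 0, b.repr x 1, b.repr x 2, ?_⟩
  simpa [b, Fin.sum_univ_three] using (b.sum_repr x).symm

open LieAlgebra LinearMap in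
/-- If the Killing form is nondegenerate, `(ad a)² = 0` forces `a = 0`. -/
lemma LieAlgebra.IsKilling.eq_zero_of_lie_lie_eq_zero {F L : Type*} [Field F] [CharZero F]
    [LieRing L] [LieAlgebra F L] [Module.Finite F L] [IsKilling F L] {a : L}
    (h : ∀ x : L, ⁅a, ⁅a, x⁆⁆ = 0) : a = 0 := by
  refine ker_eq_bot'.mp (IsKilling.ker_killingForm_eq_bot F L) a ?_
  ext y
  rw [killingForm_apply_apply, LinearMap.zero_apply]
  refine (isNilpotent_trace_of_isNilpotent ⟨2, ?_⟩).eq_zero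
  have hlie (u v : L) : ⁅⁅a, u⁆, ⁅a, v⁆⁆ = 0 := by
    have := h ⁅u, v⁆
    rw [leibniz_lie a u v, lie_add, leibniz_lie a ⁅a, u⁆ v, leibniz_lie a u ⁅a, v⁆, h, h,
      zero_lie, lie_zero, zero_add, add_zero, ← two_smul F] at this
    exact (smul_eq_zero.mp this).resolve_left two_ne_zero
  ext x
  simp only [pow_two, Module.End.mul_apply, comp_apply, ad_apply, LinearMap.zero_apply]
  rw [leibniz_lie a y, hlie, h, lie_zero, add_zero]

namespace IsSl2Triple

open LieAlgebra SpecialLinear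

variable {F L : Type*} [Field F] [CharZero F] [LieRing L] [LieAlgebra F L] {h e f : L}

lemma linearIndependent (t : IsSl2Triple h e f) : LinearIndependent F ![e, h, f] := by
  refine LinearMap.linearIndependent_of_chain (D := ad F L e) (c := -2) (by norm_num)
    t.e_ne_zero t.lie_e_f ?_ (lie_self e)
  rw [ad_apply, ← lie_skew, t.lie_h_e_smul F, neg_smul]

/-- The homomorphism from `sl₂` determined by an `sl₂` triple. -/
def slHom (t : IsSl2Triple h e f) : sl (Fin 2) F →ₗ⁅F⁆ L where
  toFun A := A.val 0 1 • e + A.val 0 0 • h + A.val 1 0 • f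
  map_add' A B := by
    have hadd (i j : Fin 2) : (A + B).val i j = A.val i j + B.val i j := rfl
    simp only [hadd]
    module
  map_smul' r A := by
    have hsmul (i j : Fin 2) : (r • A).val i j = r * A.val i j := rfl
    simp only [hsmul, RingHom.id_apply]
    module
  map_lie' {A B} := by
    have htr (C : sl (Fin 2) F) : C.val 1 1 = -C.val 0 0 := by
      have : C.val.trace = 0 := C.2
      rw [Matrix.trace_fin_two] at this
      linear_combination this
    have hfe : ⁅f, e⁆ = -h := by rw [← lie_skew, t.lie_e_f]
    have heh : ⁅e, h⁆ = -((2 : F) • e) := by rw [← lie_skew, t.lie_h_e_smul F]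
    have hfh : ⁅f, h⁆ = (2 : F) • f := by rw [← lie_skew, t.lie_lie_smul_f F, neg_neg]
    simp only [sl_bracket, Matrix.sub_apply, Matrix.mul_apply, Fin.sum_univ_two, htr, lie_add,
      add_lie, lie_smul, smul_lie, lie_self, t.lie_e_f, t.lie_h_e_smul F, t.lie_lie_smul_f F,
      hfe, heh, hfh]
    module

lemma slHom_bijective (t : IsSl2Triple h e f) (hdim : Module.finrank F L = 3) :
    Function.Bijective (t.slHom (F := F)) := by
  constructor
  · refine (injective_iff_map_eq_zero _).mpr fun A hA ↦ ?_
    have hli := Fintype.linearIndependent_iff.mp (t.linearIndependent (F := F))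
      ![A.val 0 1, A.val 0 0, A.val 1 0] (by simpa [Fin.sum_univ_three, slHom] using hA)
    have h₀₁ : A.val 0 1 = 0 := hli 0
    have h₀₀ : A.val 0 0 = 0 := hli 1
    have h₁₀ : A.val 1 0 = 0 := hli 2
    have htr : A.val.trace = 0 := A.2
    rw [Matrix.trace_fin_two, h₀₀, zero_add] at htr
    ext i j
    fin_cases i <;> fin_cases j <;> assumption
  · intro x
    obtain ⟨α, β, γ, rfl⟩ :=
      (t.linearIndependent (F := F)).exists_eq_smul_add_smul_add_smul hdim x
    have hmem : !![β, α; γ, -β] ∈ sl (Fin 2) F := by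
      change Matrix.trace !![β, α; γ, -β] = 0
      simp [Matrix.trace_fin_two]
    exact ⟨⟨_, hmem⟩, by simp [slHom]⟩

end IsSl2Triple

open LieAlgebra in
/-- In a three-dimensional Lie algebra, an element `a` with `(ad a)² ≠ 0` and `(ad a)³ = 0`
is the nilpositive element of an `sl₂` triple. -/
lemma LieAlgebra.exists_isSl2Triple_of_lie_lie_ne_zero {F L : Type*} [Field F] [CharZero F]
    [LieRing L] [LieAlgebra F L] (hdim : Module.finrank F L = 3) {a y : L}
    (hy : ⁅a, ⁅a, y⁆⁆ ≠ 0) (hy₃ : ⁅a, ⁅a, ⁅a, y⁆⁆⁆ = 0) : ∃ h f : L, IsSl2Triple h a f := by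
  have ha : a ≠ 0 := by rintro rfl; simp at hy
  obtain ⟨c, hc⟩ : ∃ c : F, a = c • ⁅a, ⁅a, y⁆⁆ := by
    have hli := LinearMap.linearIndependent_of_chain (D := ad F L a) (one_ne_zero (α := F)) hy
      rfl (one_smul F _).symm hy₃
    obtain ⟨α, β, γ, hx⟩ := hli.exists_eq_smul_add_smul_add_smul hdim a
    have hzero : β • ⁅a, ⁅a, y⁆⁆ + γ • ⁅a, y⁆ = 0 := by
      simpa [hy₃] using congr(⁅a, $hx⁆).symm
    have hcoeff := Fintype.linearIndependent_iff.mp hli ![β, γ, 0]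
      (by simpa [Fin.sum_univ_three] using hzero)
    have hβ : β = 0 := hcoeff 0
    have hγ : γ = 0 := hcoeff 1
    exact ⟨α, by simpa [hβ, hγ] using hx⟩
  obtain ⟨z, hz⟩ : ∃ z : L, ⁅a, ⁅a, z⁆⁆ = (-2 : F) • a :=
    ⟨(-2 * c) • y, by rw [lie_smul, lie_smul, mul_smul, ← hc]⟩
  obtain ⟨h, hh⟩ : ∃ h, ⁅a, z⁆ = h := ⟨_, rfl⟩
  rw [hh] at hz
  have hli : LinearIndependent F ![a, h, z] := LinearMap.linearIndependent_of_chain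
    (D := ad F L a) (c := -2) (by norm_num) ha hh hz (lie_self a)
  obtain ⟨α, β, γ, hx⟩ := hli.exists_eq_smul_add_smul_add_smul hdim ⁅h, z⁆
  have hzero : (-2 * β) • a + (γ + 2) • h = 0 := by
    have := congr(⁅a, $hx⁆)
    rw [leibniz_lie, hz, hh, lie_self, smul_lie, hh, lie_add, lie_add, lie_smul, lie_smul,
      lie_smul, lie_self, hz, hh] at this
    refine Eq.trans ?_ (neg_eq_zero.mpr (sub_eq_zero.mpr this))
    module
  have hcoeff := Fintype.linearIndependent_iff.mp hli ![-2 * β, γ + 2, 0]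
    (by simpa [Fin.sum_univ_three] using hzero)
  have hβ : β = 0 := by simpa using hcoeff 0
  have hγ : γ = -2 := eq_neg_of_add_eq_zero_left (hcoeff 1)
  have hha : ⁅h, a⁆ = (2 : F) • a := by rw [← lie_skew, hz, neg_smul, neg_neg]
  refine ⟨h, z + (-α / 4) • a, ⟨?_, ?_, ?_, ?_⟩⟩
  · exact hli.ne_zero 1
  · rw [lie_add, lie_smul, lie_self, smul_zero, add_zero, hh]
  · rw [hha, two_smul, two_nsmul]
  · rw [lie_add, lie_smul, hha, hx, hβ, hγ, ← Nat.cast_smul_eq_nsmul F]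
    module

open LieAlgebra LinearMap in
/-- If `(ad a)³ = 0`, then `a` is isotropic for the Killing form. -/
lemma LieAlgebra.killingForm_self_eq_zero_of_lie_lie_lie_eq_zero {F L : Type*} [Field F]
    [LieRing L] [LieAlgebra F L] {a : L}
    (h : ∀ x : L, ⁅a, ⁅a, ⁅a, x⁆⁆⁆ = 0) : killingForm F L a a = 0 := by
  rw [killingForm_apply_apply]
  refine (isNilpotent_trace_of_isNilpotent ⟨2, ?_⟩).eq_zero
  ext x
  simp [pow_two, h]

/-- Let `F` be a field of characteristic zero and `L` a semisimple
Lie algebra over `F` of dimension 3 (semisimple in the sense that its Killing form is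
nondegenerate, captured by `LieAlgebra.IsKilling`).  Then `L` is isomorphic to `sl₂(F)`
if and only if the Killing form of `L` is isotropic, i.e. there is a nonzero `a ∈ L`
with `κ(a, a) = 0`. -/
theorem sl2_iff_killing_isotropic
    (F : Type*) [Field F] [CharZero F]
    (L : Type*) [LieRing L] [LieAlgebra F L] [Module.Finite F L]
    [LieAlgebra.IsKilling F L]
    (hdim : Module.finrank F L = 3) :
    Nonempty (L ≃ₗ⁅F⁆ LieAlgebra.SpecialLinear.sl (Fin 2) F) ↔
      ∃ a : L, a ≠ 0 ∧ killingForm F L a a = 0 := by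
  constructor
  · rintro ⟨φ⟩
    let E := LieAlgebra.SpecialLinear.single (0 : Fin 2) 1 zero_ne_one (1 : F)
    have hE : E ≠ 0 := fun h ↦ by simpa [E] using congr(($h).val 0 1)
    refine ⟨φ.symm E, by simpa using hE, ?_⟩
    have hE₃ (A : LieAlgebra.SpecialLinear.sl (Fin 2) F) : ⁅E, ⁅E, ⁅E, A⁆⁆⁆ = 0 := by
      apply Subtype.ext
      simp only [LieAlgebra.SpecialLinear.sl_bracket, E, LieAlgebra.SpecialLinear.val_single]
      ext i j
      fin_cases i <;> fin_cases j <;>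
        simp [Matrix.mul_apply, Fin.sum_univ_two, Matrix.single_apply]
    refine LieAlgebra.killingForm_self_eq_zero_of_lie_lie_lie_eq_zero fun x ↦ ?_
    have hx := congr(φ.symm $(hE₃ (φ x)))
    rwa [LieEquiv.map_lie, LieEquiv.map_lie, LieEquiv.map_lie, LieEquiv.symm_apply_apply,
      _root_.map_zero] at hx
  · rintro ⟨a, ha, hκ⟩
    obtain ⟨y, hy⟩ : ∃ y : L, ⁅a, ⁅a, y⁆⁆ ≠ 0 := by
      by_contra! hzero
      exact ha (LieAlgebra.IsKilling.eq_zero_of_lie_lie_eq_zero (F := F) hzero)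
    have hy₃ : ⁅a, ⁅a, ⁅a, y⁆⁆⁆ = 0 :=
      LinearMap.pow_three_eq_zero_of_trace_eq_zero hdim (D := LieAlgebra.ad F L a) ha (lie_self a)
        (LieAlgebra.IsKilling.trace_ad_eq_zero a) hκ y
    obtain ⟨h, f, t⟩ := LieAlgebra.exists_isSl2Triple_of_lie_lie_ne_zero hdim hy hy₃
    exact ⟨(LieEquiv.ofBijective t.slHom (t.slHom_bijective hdim)).symm⟩
end

section
/- Let F be a field of characteristic zero and let L be a semisimple Lie algebra over F of dimension 3. Then for every nonzero b ∈ L, the kernel of ad(b) : L → L is the one-dimensional subspace spanned by b. -/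
/-- In a finite-dimensional Killing Lie algebra, every linear functional that vanishes on all
brackets is zero. -/
lemma eq_zero_of_forall_apply_lie_eq_zero
    {F L : Type*} [Field F] [LieRing L] [LieAlgebra F L] [Module.Finite F L]
    [LieAlgebra.IsKilling F L] (f : L →ₗ[F] F) (hf : ∀ y z : L, f ⁅y, z⁆ = 0) : f = 0 := by
  have hK := LieAlgebra.IsKilling.killingForm_nondegenerate F L
  obtain ⟨x, rfl⟩ : ∃ x, killingForm F L x = f := by
    refine LinearMap.injective_iff_surjective_of_finrank_eq_finrank
      Subspace.dual_finrank_eq.symm |>.mp ?_ f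
    exact LinearMap.ker_eq_bot.mp (LieAlgebra.IsKilling.ker_killingForm_eq_bot F L)
  have hx : x ∈ LieAlgebra.center F L := by
    refine (LieModule.mem_maxTrivSubmodule F L L x).mpr fun y => ?_
    rw [← lie_skew, neg_eq_zero]
    refine hK.1 _ fun z => ?_
    rw [LieModule.traceForm_apply_lie_apply]
    exact hf y z
  rw [LieAlgebra.center_eq_bot, LieSubmodule.mem_bot] at hx
  rw [hx, map_zero]

/-- If `b`, `c`, `d` span a Lie algebra and `b`, `c` commute, then all brackets lie in the span of
`⁅b, d⁆` and `⁅c, d⁆`. -/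
lemma lie_mem_span_pair_of_span_eq_top
    {F L : Type*} [Field F] [LieRing L] [LieAlgebra F L] {b c d : L} (hbc : ⁅b, c⁆ = 0)
    (hspan : Submodule.span F {b, c, d} = ⊤) (y z : L) :
    ⁅y, z⁆ ∈ Submodule.span F {⁅b, d⁆, ⁅c, d⁆} := by
  have hy : y ∈ Submodule.span F {b, c, d} := hspan ▸ Submodule.mem_top
  have hz : z ∈ Submodule.span F {b, c, d} := hspan ▸ Submodule.mem_top
  obtain ⟨p, q, r, rfl⟩ := Submodule.mem_span_triple.mp hy
  obtain ⟨p', q', r', rfl⟩ := Submodule.mem_span_triple.mp hz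
  have hcb : ⁅c, b⁆ = 0 := by rw [← lie_skew, hbc, neg_zero]
  refine Submodule.mem_span_pair.mpr ⟨p * r' - r * p', q * r' - r * q', ?_⟩
  simp only [add_lie, lie_add, smul_lie, lie_smul, lie_self, hbc, hcb, ← lie_skew d b,
    ← lie_skew d c]
  module

/-- Let `F` be a field of characteristic zero and `L` a semisimple
Lie algebra over `F` of dimension 3 (semisimplicity expressed via nondegeneracy of the
Killing form, `LieAlgebra.IsKilling`).  Then for every nonzero `b ∈ L` the kernel of
`ad(b) : L → L` is the one-dimensional subspace spanned by `b`. -/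
theorem ker_ad_eq_span_self
    (F : Type*) [Field F] [CharZero F]
    (L : Type*) [LieRing L] [LieAlgebra F L] [Module.Finite F L]
    [LieAlgebra.IsKilling F L]
    (hdim : Module.finrank F L = 3)
    (b : L) (hb : b ≠ 0) :
    LinearMap.ker (LieAlgebra.ad F L b) = Submodule.span F {b} := by
  have hdim' : Module.finrank F L = Fintype.card (Fin 3) := by simpa using hdim
  refine le_antisymm (fun c hc => ?_) ?_
  · by_contra hcb
    have hbc : ⁅b, c⁆ = 0 := hc
    have hli : LinearIndependent F ![c, b] := by
      rw [linearIndependent_fin2]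
      exact ⟨hb, fun a ha => hcb (Submodule.mem_span_singleton.mpr ⟨a, ha⟩)⟩
    have hlt : Submodule.span F (Set.range ![c, b]) ≠ ⊤ := fun h => by
      have := finrank_range_le_card (R := F) ![c, b]
      rw [Set.finrank, h, finrank_top, hdim] at this
      simp at this
    obtain ⟨d, -, hd⟩ := SetLike.exists_of_lt (lt_top_iff_ne_top.mpr hlt)
    have hspan : Submodule.span F {b, c, d} = ⊤ := by
      have := (linearIndependent_finCons.mpr ⟨hli, hd⟩).span_eq_top_of_card_eq_finrank hdim'.symm
      rw [← this]
      congr 1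
      ext x
      simp [Matrix.range_cons]
    have hlt' : Submodule.span F {⁅b, d⁆, ⁅c, d⁆} < ⊤ := by
      refine lt_top_iff_ne_top.mpr fun h => ?_
      have := finrank_range_le_card (R := F) ![⁅b, d⁆, ⁅c, d⁆]
      rw [Set.finrank, Matrix.range_cons_cons_empty, h, finrank_top, hdim] at this
      simp at this
    obtain ⟨f, hf0, hf⟩ := Submodule.exists_le_ker_of_lt_top _ hlt'
    exact hf0 (eq_zero_of_forall_apply_lie_eq_zero f fun y z =>
      hf (lie_mem_span_pair_of_span_eq_top hbc hspan y z))
  · simp [Submodule.span_singleton_le_iff_mem]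
end

section
/- Let F be a field of characteristic zero and let L be a semisimple Lie algebra over F of dimension 3. If a ∈ L is a nonzero element such that ad(a) : L → L is nilpotent, then there exists an element b ∈ L with ⁅a,b⁆ = a. -/
/-- If `x` and `y` commute and `ad x` is nilpotent, then `x` and `y` are orthogonal with respect
to the Killing form. -/
theorem killingForm_apply_eq_zero_of_lie_eq_zero_of_isNilpotent
    {F L : Type*} [Field F] [LieRing L] [LieAlgebra F L] [Module.Finite F L] {x y : L}
    (hxy : ⁅x, y⁆ = 0) (hx : IsNilpotent (LieAlgebra.ad F L x)) :
    killingForm F L x y = 0 := by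
  have hcomm : Commute (LieAlgebra.ad F L x) (LieAlgebra.ad F L y) := by
    ext z
    simp [leibniz_lie x y z, hxy]
  rw [killingForm_apply_apply]
  exact (LinearMap.isNilpotent_trace_of_isNilpotent (hcomm.isNilpotent_mul_right hx)).eq_zero

/-- In a Lie algebra with nondegenerate Killing form, every ad-nilpotent element `a` lies in the
range of `ad a`. -/
theorem mem_range_ad_self_of_isNilpotent
    {F L : Type*} [Field F] [LieRing L] [LieAlgebra F L] [Module.Finite F L]
    [LieAlgebra.IsKilling F L] {a : L} (hn : IsNilpotent (LieAlgebra.ad F L a)) :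
    a ∈ LinearMap.range (LieAlgebra.ad F L a) := by
  by_contra hmem
  obtain ⟨f, hfa, hf⟩ := Submodule.exists_le_ker_of_notMem hmem
  have hκ := LieAlgebra.IsKilling.killingForm_nondegenerate F L
  obtain ⟨c, rfl⟩ := ((killingForm F L).toDual hκ).surjective f
  have hca : ⁅c, a⁆ = 0 := by
    refine hκ.1 _ fun x ↦ ?_
    rw [LieModule.traceForm_apply_lie_apply]
    exact hf ⟨x, rfl⟩
  apply hfa
  rw [LinearMap.BilinForm.toDual_def, LieModule.traceForm_comm]
  exact killingForm_apply_eq_zero_of_lie_eq_zero_of_isNilpotent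
    (by rw [← lie_skew, hca, neg_zero]) hn


/-- Let `F` be a field of characteristic zero and `L` a semisimple
Lie algebra over `F` of dimension 3 (semisimplicity expressed via nondegeneracy of the
Killing form, `LieAlgebra.IsKilling`).  If `a ∈ L` is nonzero with `ad(a)` nilpotent,
then there exists `b ∈ L` with `⁅a, b⁆ = a`. -/
theorem exists_lie_eq_self_of_ad_nilpotent
    (F : Type*) [Field F] [CharZero F]
    (L : Type*) [LieRing L] [LieAlgebra F L] [Module.Finite F L]
    [LieAlgebra.IsKilling F L]
    (hdim : Module.finrank F L = 3)
    (a : L) (ha : a ≠ 0) (hn : IsNilpotent (LieAlgebra.ad F L a)) :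
    ∃ b : L, ⁅a, b⁆ = a := by
  exact mem_range_ad_self_of_isNilpotent hn
end

section
/- Let F be a field of characteristic zero and let L be a semisimple Lie algebra over F of dimension 3. If there exist elements a, b ∈ L with a ≠ 0 and ⁅a,b⁆ = a, then L is isomorphic (as a Lie algebra over F) to sl₂(F). -/
section

variable {F L : Type*} [Field F] [LieRing L] [LieAlgebra F L]

/-- The homomorphism from `sl₂` determined by an `sl₂`-triple. -/
def IsSl2Triple.slHom_s4 {h e f : L} (t : IsSl2Triple h e f) :
    LieAlgebra.SpecialLinear.sl (Fin 2) F →ₗ⁅F⁆ L where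
  toFun A := A.val 0 0 • h + A.val 0 1 • e + A.val 1 0 • f
  map_add' A B := by
    change (A.val 0 0 + B.val 0 0) • h + (A.val 0 1 + B.val 0 1) • e +
      (A.val 1 0 + B.val 1 0) • f = _
    module
  map_smul' c A := by
    change (c * A.val 0 0) • h + (c * A.val 0 1) • e + (c * A.val 1 0) • f = c • _
    module
  map_lie' {A B} := by
    have trace_eq (C : LieAlgebra.SpecialLinear.sl (Fin 2) F) : C.val 1 1 = -C.val 0 0 := by
      have hC : Matrix.trace C.val = 0 := C.property
      rw [Matrix.trace_fin_two] at hC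
      exact eq_neg_of_add_eq_zero_right hC
    have lie_e_h : ⁅e, h⁆ = -((2 : F) • e) := by rw [← lie_skew, t.lie_h_e_smul F]
    have lie_f_h : ⁅f, h⁆ = (2 : F) • f := by rw [← lie_skew, t.lie_lie_smul_f F, neg_neg]
    have lie_f_e : ⁅f, e⁆ = -h := by rw [← lie_skew, t.lie_e_f]
    simp only [LieAlgebra.SpecialLinear.sl_bracket, Matrix.sub_apply, Matrix.mul_apply,
      Fin.sum_univ_two, trace_eq, add_lie, lie_add, smul_lie, lie_smul, lie_self,
      t.lie_h_e_smul F, t.lie_lie_smul_f F, t.lie_e_f, lie_e_h, lie_f_h, lie_f_e]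
    module

lemma linearIndependent_of_lie_eq_smul [CharZero F] {x e f : L} {μ : F} (hμ : μ ≠ 0)
    (hx : x ≠ 0) (he : e ≠ 0) (hf : f ≠ 0) (hxe : ⁅x, e⁆ = μ • e) (hxf : ⁅x, f⁆ = -μ • f) :
    LinearIndependent F ![x, e, f] := by
  refine Module.End.eigenvectors_linearIndependent' (LieAlgebra.ad F L x) ![0, μ, -μ] ?_ _ ?_
  · have hμ' : μ ≠ -μ := fun h ↦ hμ (self_eq_neg.mp h)
    intro i j hij
    fin_cases i <;> fin_cases j <;> simp_all [eq_comm]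
  · intro i
    rw [Module.End.hasEigenvector_iff, Module.End.mem_eigenspace_iff]
    fin_cases i <;> simp_all

lemma exists_eq_smul_add_of_finrank_eq_three [Module.Finite F L]
    (hdim : Module.finrank F L = 3) {x e f : L}
    (hli : LinearIndependent F ![x, e, f]) (y : L) :
    ∃ α β γ : F, y = α • x + β • e + γ • f := by
  have hspan := hli.span_eq_top_of_card_eq_finrank' (by simp [hdim])
  have hy : y ∈ Submodule.span F (Set.range ![x, e, f]) := hspan ▸ Submodule.mem_top
  obtain ⟨c, rfl⟩ := (Submodule.mem_span_range_iff_exists_fun F).mp hy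
  exact ⟨c 0, c 1, c 2, by simp [Fin.sum_univ_three]⟩

lemma IsSl2Triple.slHom_bijective_s4 [CharZero F] [Module.Finite F L]
    (hdim : Module.finrank F L = 3) {h e f : L} (t : IsSl2Triple h e f) : Function.Bijective (t.slHom_s4 (F := F)) := by
  have hli : LinearIndependent F ![h, e, f] :=
    linearIndependent_of_lie_eq_smul two_ne_zero t.h_ne_zero t.e_ne_zero t.f_ne_zero
      (t.lie_h_e_smul F) (by rw [t.lie_lie_smul_f F, neg_smul])
  constructor
  · refine (injective_iff_map_eq_zero _).mpr fun A hA ↦ ?_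
    have hcoeff := Fintype.linearIndependent_iff.mp hli ![A.val 0 0, A.val 0 1, A.val 1 0]
      (by simpa [Fin.sum_univ_three, IsSl2Triple.slHom_s4] using hA)
    have h00 : A.val 0 0 = 0 := hcoeff 0
    have h01 : A.val 0 1 = 0 := hcoeff 1
    have h10 : A.val 1 0 = 0 := hcoeff 2
    have htr : Matrix.trace A.val = 0 := A.property
    rw [Matrix.trace_fin_two, h00, zero_add] at htr
    ext i j
    fin_cases i <;> fin_cases j <;> assumption
  · intro y
    obtain ⟨α, β, γ, rfl⟩ := exists_eq_smul_add_of_finrank_eq_three hdim hli y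
    refine ⟨⟨!![α, β; γ, -α], ?_⟩, ?_⟩
    · change Matrix.trace !![α, β; γ, -α] = 0
      simp [Matrix.trace_fin_two]
    · simp [IsSl2Triple.slHom_s4]

variable [LieAlgebra.IsKilling F L]

lemma LieAlgebra.IsKilling.eq_zero_of_forall_killingForm_eq_zero {x : L}
    (hx : ∀ y, killingForm F L x y = 0) : x = 0 :=
  (LieAlgebra.IsKilling.killingForm_nondegenerate F L).1 x hx

/-- In a Lie algebra with nondegenerate Killing form, the eigenvalues of `ad x` are closed under
negation. -/
lemma LieAlgebra.IsKilling.exists_lie_eq_neg_smul [Module.Finite F L] {x e : L} {μ : F}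
    (he : e ≠ 0) (hxe : ⁅x, e⁆ = μ • e) : ∃ f : L, f ≠ 0 ∧ ⁅x, f⁆ = -μ • f := by
  by_contra! hf
  set T : Module.End F L := LieAlgebra.ad F L x + μ • LinearMap.id
  have hinj : Function.Injective T := by
    refine (injective_iff_map_eq_zero T).mpr fun f hTf ↦ by_contra fun hne ↦ hf f hne ?_
    rw [neg_smul]
    exact eq_neg_of_add_eq_zero_left hTf
  refine he (eq_zero_of_forall_killingForm_eq_zero (F := F) fun y ↦ ?_)
  obtain ⟨z, rfl⟩ := LinearMap.surjective_of_injective hinj y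
  have hinv := LieModule.traceForm_apply_lie_apply' F L L x e z
  rw [hxe] at hinv
  simp only [map_smul, LinearMap.smul_apply] at hinv
  change killingForm F L e (⁅x, z⁆ + μ • z) = 0
  rw [map_add, map_smul, hinv, add_neg_cancel]

end

/-- Let `F` be a field of characteristic zero and `L` a semisimple
Lie algebra over `F` of dimension 3 (semisimplicity expressed via nondegeneracy of the
Killing form, `LieAlgebra.IsKilling`).  If there are `a, b ∈ L` with `a ≠ 0` and
`⁅a, b⁆ = a`, then `L` is isomorphic to `sl₂(F)`. -/
theorem sl2_of_exists_lie_eq_self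
    (F : Type*) [Field F] [CharZero F]
    (L : Type*) [LieRing L] [LieAlgebra F L] [Module.Finite F L]
    [LieAlgebra.IsKilling F L]
    (hdim : Module.finrank F L = 3)
    (a b : L) (ha : a ≠ 0) (hab : ⁅a, b⁆ = a) :
    Nonempty (L ≃ₗ⁅F⁆ LieAlgebra.SpecialLinear.sl (Fin 2) F) := by
  have hba : ⁅b, a⁆ = (-1 : F) • a := by rw [← lie_skew, hab, neg_one_smul]
  have hb : b ≠ 0 := fun h ↦ ha (by rw [← hab, h, lie_zero])
  obtain ⟨c, hc, hbc⟩ := LieAlgebra.IsKilling.exists_lie_eq_neg_smul ha hba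
  have hli := linearIndependent_of_lie_eq_smul (neg_ne_zero.mpr one_ne_zero) hb ha hc hba hbc
  rw [neg_neg, one_smul] at hbc
  have hspan := exists_eq_smul_add_of_finrank_eq_three hdim hli
  obtain ⟨l, hac⟩ : ∃ l : F, ⁅a, c⁆ = l • b := by
    obtain ⟨α, β, γ, h⟩ := hspan ⁅a, c⁆
    have hjac : ⁅b, ⁅a, c⁆⁆ = 0 := by
      rw [leibniz_lie, hba, hbc, smul_lie, neg_one_smul, neg_add_cancel]
    rw [h] at hjac
    have hcoeff := Fintype.linearIndependent_iff.mp hli ![0, -β, γ]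
      (by simpa [Fin.sum_univ_three, hba, hbc] using hjac)
    have hβ : β = 0 := neg_eq_zero.mp (hcoeff 1)
    have hγ : γ = 0 := hcoeff 2
    exact ⟨α, by rw [h, hβ, hγ, zero_smul, zero_smul, add_zero, add_zero]⟩
  have hl : l ≠ 0 := by
    rintro rfl
    rw [zero_smul] at hac
    have horth (y : L) (hy : killingForm F L b ⁅a, y⁆ = 0) : killingForm F L a y = 0 := by
      have hinv := LieModule.traceForm_apply_lie_apply' F L L a b y
      rw [hab] at hinv
      exact hinv.trans (neg_eq_zero.mpr hy)
    have ha_a : killingForm F L a a = 0 := horth a (by rw [lie_self, map_zero])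
    have ha_c : killingForm F L a c = 0 := horth c (by rw [hac, map_zero])
    have ha_b : killingForm F L a b = 0 := by
      have hinv := LieModule.traceForm_apply_lie_apply F L L a b b
      rw [hab, lie_self, map_zero] at hinv
      exact hinv
    refine ha (LieAlgebra.IsKilling.eq_zero_of_forall_killingForm_eq_zero (F := F) fun y ↦ ?_)
    obtain ⟨α, β, γ, rfl⟩ := hspan y
    simp only [map_add, map_smul, ha_a, ha_b, ha_c, smul_zero, add_zero]
  have t : IsSl2Triple ((-2 : F) • b) a ((-2 * l⁻¹) • c) :=
    { h_ne_zero := smul_ne_zero (neg_ne_zero.mpr two_ne_zero) hb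
      lie_e_f := by rw [lie_smul, hac, smul_smul, mul_assoc, inv_mul_cancel₀ hl, mul_one]
      lie_h_e_nsmul := by
        rw [smul_lie, hba]
        module
      lie_h_f_nsmul := by
        rw [smul_lie, lie_smul, hbc]
        module }
  exact ⟨(LieEquiv.ofBijective t.slHom_s4 (t.slHom_bijective_s4 hdim)).symm⟩
end

section
/- Let F be a field of characteristic zero and let E be a quadratic field extension of F. Let L be a finite-dimensional simple Lie algebra over F such that the base change E ⊗_F L is isomorphic, as a Lie algebra over E, to sl₂(E) ⊕ sl₂(E). Then L is isomorphic, as a Lie algebra over F, to sl₂(E) regarded as a Lie algebra over F by restriction of scalars. -/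
open scoped TensorProduct

/-- The product of two Lie rings, with componentwise bracket. -/
instance prodLieRing (L M : Type*) [LieRing L] [LieRing M] : LieRing (L × M) where
  bracket p q := (⁅p.1, q.1⁆, ⁅p.2, q.2⁆)
  add_lie x y z := by
    show (⁅x.1 + y.1, z.1⁆, ⁅x.2 + y.2, z.2⁆)
        = (⁅x.1, z.1⁆, ⁅x.2, z.2⁆) + (⁅y.1, z.1⁆, ⁅y.2, z.2⁆)
    simp [add_lie, Prod.mk_add_mk]
  lie_add x y z := by
    show (⁅x.1, y.1 + z.1⁆, ⁅x.2, y.2 + z.2⁆)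
        = (⁅x.1, y.1⁆, ⁅x.2, y.2⁆) + (⁅x.1, z.1⁆, ⁅x.2, z.2⁆)
    simp [lie_add, Prod.mk_add_mk]
  lie_self x := by
    show (⁅x.1, x.1⁆, ⁅x.2, x.2⁆) = (0 : L × M)
    simp
  leibniz_lie x y z := by
    show (⁅x.1, ⁅y.1, z.1⁆⁆, ⁅x.2, ⁅y.2, z.2⁆⁆)
        = (⁅⁅x.1, y.1⁆, z.1⁆, ⁅⁅x.2, y.2⁆, z.2⁆) + (⁅y.1, ⁅x.1, z.1⁆⁆, ⁅y.2, ⁅x.2, z.2⁆⁆)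
    simp [Prod.mk_add_mk]

/-- The product of two Lie algebras, with componentwise bracket. -/
instance prodLieAlgebra (R L M : Type*) [CommRing R] [LieRing L] [LieRing M]
    [LieAlgebra R L] [LieAlgebra R M] : LieAlgebra R (L × M) where
  lie_smul t x y := by
    show (⁅x.1, t • y.1⁆, ⁅x.2, t • y.2⁆) = t • (⁅x.1, y.1⁆, ⁅x.2, y.2⁆)
    simp [Prod.smul_mk]

section BaseChange

open LieAlgebra

/-- The composition of `x ↦ 1 ⊗ x` with a homomorphism of Lie algebras over `E` out of
`E ⊗[F] L`, as a homomorphism of Lie algebras over `F`. -/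
def LieHom.restrictBaseChange {F E L S : Type*} [Field F] [Field E] [Algebra F E]
    [LieRing L] [LieAlgebra F L] [LieRing S] [LieAlgebra E S] (f : E ⊗[F] L →ₗ⁅E⁆ S) :
    L →ₗ⁅F⁆ RestrictScalars F E S where
  toFun x := f (1 ⊗ₜ x)
  map_add' x y := by
    rw [TensorProduct.tmul_add]
    exact map_add f _ _
  map_smul' c x := by
    have hc : (1 : E) ⊗ₜ[F] (c • x) = algebraMap F E c • ((1 : E) ⊗ₜ[F] x) := by
      rw [TensorProduct.tmul_smul, algebraMap_smul]
    rw [hc]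
    exact map_smul f _ _
  map_lie' {x y} := by
    have hxy : (1 : E) ⊗ₜ[F] ⁅x, y⁆ = ⁅(1 : E) ⊗ₜ[F] x, (1 : E) ⊗ₜ[F] y⁆ := by
      rw [ExtendScalars.bracket_tmul, one_mul]
    rw [hxy]
    exact f.map_lie _ _

theorem LieHom.restrictBaseChange_injective {F E L S : Type*} [Field F] [Field E] [Algebra F E]
    [LieRing L] [LieAlgebra F L] [LieAlgebra.IsSimple F L] [LieRing S] [LieAlgebra E S]
    [Nontrivial S] (f : E ⊗[F] L →ₗ⁅E⁆ S) (hf : Function.Surjective f) :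
    Function.Injective f.restrictBaseChange := by
  rw [← LieHom.ker_eq_bot]
  refine (IsSimple.eq_bot_or_eq_top (R := F) f.restrictBaseChange.ker).resolve_right fun htop ↦ ?_
  have hzero (x : L) : f (1 ⊗ₜ x) = 0 :=
    LieHom.mem_ker.mp (htop ▸ LieSubmodule.mem_top x : x ∈ f.restrictBaseChange.ker)
  obtain ⟨s, hs⟩ := exists_ne (0 : S)
  obtain ⟨t, rfl⟩ := hf s
  refine hs ?_
  induction t with
  | zero => exact map_zero f
  | tmul a x =>
    rw [← mul_one a, ← smul_eq_mul, ← TensorProduct.smul_tmul', map_smul, hzero, smul_zero]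
  | add t u ht hu =>
    have ht' : f t = 0 := by_contra fun h ↦ h (ht h)
    have hu' : f u = 0 := by_contra fun h ↦ h (hu h)
    rw [map_add, ht', hu', add_zero]

/-- If `L` is simple over `F` and becomes `S ⊕ S` over a quadratic extension `E`, then `L` is the
restriction of scalars of `S`. -/
theorem LieAlgebra.IsSimple.nonempty_equiv_restrictScalars {F E L S : Type*} [Field F] [Field E]
    [Algebra F E] (hE : Module.finrank F E = 2) [LieRing L] [LieAlgebra F L] [Module.Finite F L]
    [LieAlgebra.IsSimple F L] [LieRing S] [LieAlgebra E S] [Module.Finite E S] [Nontrivial S]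
    (e : (E ⊗[F] L) ≃ₗ⁅E⁆ (S × S)) : Nonempty (L ≃ₗ⁅F⁆ RestrictScalars F E S) := by
  let p : E ⊗[F] L →ₗ⁅E⁆ S :=
    { LinearMap.fst E S S ∘ₗ (e.toLinearEquiv : (E ⊗[F] L) →ₗ[E] S × S) with
      map_lie' {x y} := congrArg Prod.fst (e.map_lie x y) }
  have hp : Function.Surjective p := Prod.fst_surjective.comp e.surjective
  have hinj := p.restrictBaseChange_injective hp
  let : Module F S := Module.compHom S (algebraMap F E)
  have : IsScalarTower F E S := IsScalarTower.of_algebraMap_smul fun _ _ ↦ rfl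
  have : Module.Finite F E := Module.finite_of_finrank_pos (by omega)
  have : Module.Finite F S := Module.Finite.trans E _
  have hrank : Module.finrank F L = Module.finrank F S := calc
    Module.finrank F L = Module.finrank E (E ⊗[F] L) := Module.finrank_baseChange.symm
    _ = Module.finrank E (S × S) := e.toLinearEquiv.finrank_eq
    _ = Module.finrank F E * Module.finrank E S := by rw [Module.finrank_prod, hE, two_mul]
    _ = Module.finrank F S := Module.finrank_mul_finrank F E S
  let q : L →ₗ[F] S :=
    { toFun := p.restrictBaseChange
      map_add' := map_add p.restrictBaseChange
      map_smul' := map_smul p.restrictBaseChange }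
  have hsurj : Function.Surjective q :=
    (LinearMap.injective_iff_surjective_of_finrank_eq_finrank hrank).mp hinj
  exact ⟨LieEquiv.ofBijective p.restrictBaseChange ⟨hinj, hsurj⟩⟩

end BaseChange

/-- Let `F` be a field of characteristic zero and `E` a quadratic field
extension of `F`.  Let `L` be a finite-dimensional simple Lie algebra over `F` such that
the base change `E ⊗[F] L` is isomorphic, as a Lie algebra over `E`, to
`sl₂(E) ⊕ sl₂(E)`.  Then `L` is isomorphic, as a Lie algebra over `F`, to `sl₂(E)`
regarded as a Lie algebra over `F` by restriction of scalars. -/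
theorem simple_of_baseChange_sl2_sum_sl2
    (F : Type*) [Field F] [CharZero F]
    (E : Type*) [Field E] [Algebra F E] (hE : Module.finrank F E = 2)
    (L : Type*) [LieRing L] [LieAlgebra F L] [Module.Finite F L]
    [LieAlgebra.IsSimple F L]
    (h : Nonempty ((E ⊗[F] L) ≃ₗ⁅E⁆
      (↥(LieAlgebra.SpecialLinear.sl (Fin 2) E) × ↥(LieAlgebra.SpecialLinear.sl (Fin 2) E)))) :
    Nonempty (L ≃ₗ⁅F⁆ RestrictScalars F E ↥(LieAlgebra.SpecialLinear.sl (Fin 2) E)) := by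
  obtain ⟨e⟩ := h
  have : Nontrivial (LieAlgebra.SpecialLinear.sl (Fin 2) E) := by
    by_contra hs
    rw [not_nontrivial_iff_subsingleton] at hs
    exact LieAlgebra.SpecialLinear.sl_non_abelian (n := Fin 2) (R := E) (by simp)
      ⟨fun _ _ ↦ Subsingleton.elim _ _⟩
  exact LieAlgebra.IsSimple.nonempty_equiv_restrictScalars hE e
end

section
/- Let F be a field of characteristic zero, let E be a quadratic field extension of F, and let σ be the nontrivial F-automorphism of E. Let L be a finite-dimensional simple Lie algebra over F, and let σ_L := σ ⊗ id be the induced σ-semilinear map on the base change E ⊗_F L. If I is an ideal of the E-Lie algebra E ⊗_F L with σ_L(I) = I, then I = 0 or I = E ⊗_F L. -/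
open scoped TensorProduct

/-- In a quadratic extension, `1` and any element moved by an automorphism span the field. -/
lemma exists_eq_smul_one_add_smul_of_finrank_eq_two {F E : Type*} [Field F] [Field E]
    [Algebra F E] (hE : Module.finrank F E = 2) (σ : E ≃ₐ[F] E) {α : E} (hα : σ α ≠ α) (e : E) :
    ∃ a b : F, e = a • 1 + b • α := by
  have : FiniteDimensional F E := Module.finite_of_finrank_eq_succ hE
  have hli : LinearIndependent F ![(1 : E), α] := by
    refine (LinearIndependent.pair_iff' one_ne_zero).2 fun a ha ↦ hα ?_
    rw [← ha, map_smul, map_one]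
  have hmem : e ∈ Submodule.span F (Set.range ![(1 : E), α]) := by
    rw [hli.span_eq_top_of_card_eq_finrank' (by simp [hE])]
    trivial
  rw [Matrix.range_cons, Matrix.range_cons, Matrix.range_empty, Set.union_empty,
    Set.singleton_union, Submodule.mem_span_pair] at hmem
  obtain ⟨a, b, h⟩ := hmem
  exact ⟨a, b, h.symm⟩

lemma exists_eq_one_tmul_add_tmul_of_finrank_eq_two {F E L : Type*} [Field F] [Field E]
    [Algebra F E] [AddCommGroup L] [Module F L] (hE : Module.finrank F E = 2) (σ : E ≃ₐ[F] E)
    {α : E} (hα : σ α ≠ α) (z : E ⊗[F] L) :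
    ∃ x y : L, z = 1 ⊗ₜ[F] x + α ⊗ₜ[F] y := by
  induction z using TensorProduct.induction_on with
  | zero => exact ⟨0, 0, by simp⟩
  | tmul e l =>
    obtain ⟨a, b, rfl⟩ := exists_eq_smul_one_add_smul_of_finrank_eq_two hE σ hα e
    exact ⟨a • l, b • l, by
      rw [TensorProduct.add_tmul, TensorProduct.smul_tmul, TensorProduct.smul_tmul]⟩
  | add z w hz hw =>
    obtain ⟨x, y, rfl⟩ := hz
    obtain ⟨x', y', rfl⟩ := hw
    refine ⟨x + x', y + y', ?_⟩
    rw [TensorProduct.tmul_add, TensorProduct.tmul_add]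
    abel

/-- The contraction along `x ↦ 1 ⊗ x` of an ideal of the base change of a Lie algebra. -/
def LieIdeal.baseChangeContraction {F E L : Type*} [CommRing F] [CommRing E] [Algebra F E]
    [LieRing L] [LieAlgebra F L] (I : LieIdeal E (E ⊗[F] L)) : LieIdeal F L where
  carrier := {x | (1 : E) ⊗ₜ[F] x ∈ I}
  zero_mem' := by simp
  add_mem' {x y} hx hy := by
    simpa only [Set.mem_ofPred_eq, TensorProduct.tmul_add] using add_mem hx hy
  smul_mem' c x hx := by
    have h := I.smul_mem (algebraMap F E c) hx
    rwa [algebraMap_smul, ← TensorProduct.tmul_smul] at h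
  lie_mem {x m} hm := by
    have h := lie_mem_right E (E ⊗[F] L) I ((1 : E) ⊗ₜ[F] x) _ hm
    rwa [LieAlgebra.ExtendScalars.bracket_tmul, one_mul] at h

lemma LieIdeal.tmul_mem_of_mem_baseChangeContraction {F E L : Type*} [CommRing F] [CommRing E]
    [Algebra F E] [LieRing L] [LieAlgebra F L] {I : LieIdeal E (E ⊗[F] L)} {x : L}
    (hx : x ∈ I.baseChangeContraction) (e : E) : e ⊗ₜ[F] x ∈ I := by
  have h := I.smul_mem e (show (1 : E) ⊗ₜ[F] x ∈ I from hx)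
  rwa [TensorProduct.smul_tmul', smul_eq_mul, mul_one] at h

/-- Let `F` be a field of characteristic zero, `E` a quadratic field
extension of `F`, and `σ` the nontrivial `F`-automorphism of `E`.  Let `L` be a
finite-dimensional simple Lie algebra over `F`, and let `σ_L := σ ⊗ id` be the induced
`σ`-semilinear map on the base change `E ⊗[F] L`.  If `I` is an ideal of the `E`-Lie
algebra `E ⊗[F] L` with `σ_L(I) = I`, then `I = 0` or `I = E ⊗[F] L`. -/
theorem lieIdeal_eq_bot_or_top_of_galois_stable
    (F : Type*) [Field F] [CharZero F]
    (E : Type*) [Field E] [Algebra F E] (hE : Module.finrank F E = 2)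
    (σ : E ≃ₐ[F] E) (hσ : σ ≠ AlgEquiv.refl)
    (L : Type*) [LieRing L] [LieAlgebra F L] [Module.Finite F L]
    [LieAlgebra.IsSimple F L]
    (I : LieIdeal E (E ⊗[F] L))
    (hI : LinearMap.rTensor L (σ.toLinearMap : E →ₗ[F] E) '' (I : Set (E ⊗[F] L))
        = (I : Set (E ⊗[F] L))) :
    I = ⊥ ∨ I = ⊤ := by
  obtain ⟨α, hα⟩ : ∃ α, σ α ≠ α := by
    by_contra! h
    exact hσ (AlgEquiv.ext h)
  rcases LieAlgebra.IsSimple.eq_bot_or_eq_top I.baseChangeContraction with hJ | hJ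
  · left
    rw [LieSubmodule.eq_bot_iff]
    intro z hz
    have eq_zero_of_one_tmul_mem : ∀ x : L, (1 : E) ⊗ₜ[F] x ∈ I → x = 0 := fun x hx ↦ by
      have : x ∈ I.baseChangeContraction := hx
      rwa [hJ, LieSubmodule.mem_bot] at this
    obtain ⟨x, y, rfl⟩ := exists_eq_one_tmul_add_tmul_of_finrank_eq_two hE σ hα z
    have hσz : (1 : E) ⊗ₜ[F] x + σ α ⊗ₜ[F] y ∈ I := by
      have h := hI.subset (Set.mem_image_of_mem _ hz)
      simpa using h
    have hy : y = 0 := by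
      have hsub := sub_mem hσz hz
      rw [add_sub_add_left_eq_sub, ← TensorProduct.sub_tmul] at hsub
      have h := I.smul_mem (σ α - α)⁻¹ hsub
      rw [TensorProduct.smul_tmul', smul_eq_mul, inv_mul_cancel₀ (sub_ne_zero.2 hα)] at h
      exact eq_zero_of_one_tmul_mem y h
    subst hy
    rw [TensorProduct.tmul_zero, add_zero] at hz ⊢
    rw [eq_zero_of_one_tmul_mem x hz, TensorProduct.tmul_zero]
  · right
    rw [eq_top_iff]
    intro z _
    obtain ⟨x, y, rfl⟩ := exists_eq_one_tmul_add_tmul_of_finrank_eq_two hE σ hα z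
    have mem (l : L) : l ∈ I.baseChangeContraction := hJ ▸ LieSubmodule.mem_top l
    exact add_mem (LieIdeal.tmul_mem_of_mem_baseChangeContraction (mem x) 1)
      (LieIdeal.tmul_mem_of_mem_baseChangeContraction (mem y) α)
end

section
/- Let F be a field of characteristic zero, let E be a quadratic field extension of F, and let L denote sl₂(E) regarded as a Lie algebra over F by restriction of scalars. Then the centroid of L over F, i.e. the set of F-linear maps f : L → L satisfying f(⁅x,y⁆) = ⁅x, f(y)⁆ for all x, y ∈ L, consists exactly of the maps x ↦ e·x of multiplication by elements e ∈ E. In particular, the centroid is a 2-dimensional F-vector space isomorphic as an F-algebra to E. -/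
open LieAlgebra.SpecialLinear in
/-- The matrix `!![a, b; c, -a]` as an element of `sl₂`. -/
def sl2Mk {R : Type*} [CommRing R] (a b c : R) : sl (Fin 2) R :=
  ⟨!![a, b; c, -a], by
    change Matrix.trace (!![a, b; c, -a] : Matrix (Fin 2) (Fin 2) R) = 0
    simp [Matrix.trace_fin_two]⟩

section sl2Mk

open LieAlgebra.SpecialLinear

variable {R : Type*} [CommRing R]

lemma eq_sl2Mk (x : sl (Fin 2) R) : x = sl2Mk (x.1 0 0) (x.1 0 1) (x.1 1 0) := by
  have hx : x.1 0 0 + x.1 1 1 = 0 := by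
    rw [← Matrix.trace_fin_two]
    exact x.2
  apply Subtype.ext
  ext i j
  fin_cases i <;> fin_cases j <;> simp [sl2Mk, eq_neg_of_add_eq_zero_right hx]

lemma sl2Mk_inj {a b c a' b' c' : R} :
    sl2Mk a b c = sl2Mk a' b' c' ↔ a = a' ∧ b = b' ∧ c = c' := by
  refine ⟨fun h ↦ ?_, fun ⟨ha, hb, hc⟩ ↦ by rw [ha, hb, hc]⟩
  have h' := congrArg Subtype.val h
  exact ⟨by simpa [sl2Mk] using congrFun (congrFun h' 0) 0,
    by simpa [sl2Mk] using congrFun (congrFun h' 0) 1,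
    by simpa [sl2Mk] using congrFun (congrFun h' 1) 0⟩

lemma sl2Mk_add (a b c a' b' c' : R) :
    sl2Mk a b c + sl2Mk a' b' c' = sl2Mk (a + a') (b + b') (c + c') := by
  apply Subtype.ext
  ext i j
  fin_cases i <;> fin_cases j <;> simp [sl2Mk, add_comm]

lemma smul_sl2Mk (r a b c : R) : r • sl2Mk a b c = sl2Mk (r * a) (r * b) (r * c) := by
  apply Subtype.ext
  ext i j
  fin_cases i <;> fin_cases j <;> simp [sl2Mk]

lemma lie_sl2Mk (a b c a' b' c' : R) :
    ⁅sl2Mk a b c, sl2Mk a' b' c'⁆ =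
      sl2Mk (b * c' - b' * c) (2 * (a * b' - a' * b)) (2 * (c * a' - c' * a)) := by
  apply Subtype.ext
  ext i j
  fin_cases i <;> fin_cases j <;>
    simp [sl2Mk, LieSubalgebra.coe_bracket, Ring.lie_def] <;> ring

end sl2Mk

open LieAlgebra.SpecialLinear in
/-- Over a field in which `2` is invertible, an additive endomorphism of `sl₂` commuting with the
adjoint action is multiplication by a scalar. -/
theorem exists_eq_smul_of_map_lie_sl2 {E : Type*} [Field E] (h2 : (2 : E) ≠ 0)
    (f : sl (Fin 2) E →+ sl (Fin 2) E) (hf : ∀ x y : sl (Fin 2) E, f ⁅x, y⁆ = ⁅x, f y⁆) :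
    ∃ e : E, ∀ x, f x = e • x := by
  obtain ⟨a, ha⟩ : ∃ a : E, f (sl2Mk 1 0 0) = a • sl2Mk 1 0 0 := by
    refine ⟨(f (sl2Mk 1 0 0)).1 0 0, ?_⟩
    have h := hf (sl2Mk 1 0 0) (sl2Mk 1 0 0)
    rw [lie_self, map_zero, eq_sl2Mk (f _), lie_sl2Mk, eq_sl2Mk 0, sl2Mk_inj] at h
    rw [smul_sl2Mk]
    refine (eq_sl2Mk _).trans (sl2Mk_inj.2 ?_)
    simpa [h2, eq_comm] using h
  have off_diag (b c : E) : f (sl2Mk 0 b c) = a • sl2Mk 0 b c := by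
    have h : sl2Mk 0 b c = ⁅sl2Mk 0 (-b / 2) (c / 2), sl2Mk 1 0 0⁆ := by
      rw [lie_sl2Mk, sl2Mk_inj]
      refine ⟨?_, ?_, ?_⟩ <;> field_simp <;> ring
    rw [h, hf, ha, lie_smul]
  have diag (c : E) : f (sl2Mk c 0 0) = a • sl2Mk c 0 0 := by
    have h : sl2Mk c 0 0 = ⁅sl2Mk 0 c 0, sl2Mk 0 0 1⁆ := by
      rw [lie_sl2Mk, sl2Mk_inj]
      simp
    rw [h, hf, off_diag, lie_smul]
  refine ⟨a, fun x ↦ ?_⟩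
  have h : x = sl2Mk (x.1 0 0) 0 0 + sl2Mk 0 (x.1 0 1) (x.1 1 0) := by
    rw [sl2Mk_add]
    simpa using eq_sl2Mk x
  rw [h, map_add, diag, off_diag, smul_add]


/-- Let `F` be a field of characteristic zero, `E` a quadratic field
extension of `F`, and let `L` denote `sl₂(E)` regarded as a Lie algebra over `F` by
restriction of scalars.  Then the centroid of `L` over `F` — the set of `F`-linear
endomorphisms `f` of `L` with `f ⁅x, y⁆ = ⁅x, f y⁆` for all `x, y` — consists exactly
of the multiplications `x ↦ e • x` by elements `e ∈ E`. -/
theorem centroid_sl2_restrictScalars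
    (F : Type*) [Field F] [CharZero F]
    (E : Type*) [Field E] [Algebra F E] (hE : Module.finrank F E = 2) :
    {f : Module.End F ↥(LieAlgebra.SpecialLinear.sl (Fin 2) E) |
        ∀ x y : ↥(LieAlgebra.SpecialLinear.sl (Fin 2) E), f ⁅x, y⁆ = ⁅x, f y⁆}
      = {f : Module.End F ↥(LieAlgebra.SpecialLinear.sl (Fin 2) E) |
        ∃ e : E, ∀ x, f x = e • x} := by
  ext f
  refine ⟨fun hf ↦ ?_, ?_⟩
  · have : CharZero E := charZero_of_injective_algebraMap (algebraMap F E).injective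
    exact exists_eq_smul_of_map_lie_sl2 two_ne_zero f.toAddMonoidHom hf
  · rintro ⟨e, he⟩ x y
    rw [he, he, lie_smul]
end
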